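/- Let G be a finite group. For each conjugacy class C of G fix a representative r_C ∈ C, a transversal p_C : C → G with p_C(c)·r_C·p_C(c)⁻¹ = c, and a complete set Irr(Z(r_C)) of pairwise non-isomorphic irreducible unitary representations of the centralizer Z(r_C). Then in the ribbon algebra of G, Σ over conjugacy classes C, over R ∈ Irr(Z(r_C)), over 1 ≤ m ≤ d_R, and over c ∈ C of P^{[C,R]}_{m,c} equals the multiplicative identity Σ_{g∈G} F^{g,e}. -/

import Mathlib

/-!
Statement 8: Completeness of the diagonal probing operators: summing `P^{[C,R]}_{m,c}` over
all conjugacy classes `C`, all irreducible unitary representations `R` of `Z(r_C)` (taken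
from a complete set of pairwise non-isomorphic ones), all `1 ≤ m ≤ d_R` and all `c ∈ C`
yields the multiplicative identity `Σ_{g∈G} F^{g,e}` of the ribbon algebra.
-/

open scoped Classical

noncomputable section

/-- `F^{g,h}`: the indicator function of the pair `(g,h)`. -/
def Fgh {G : Type*} (g h : G) : G × G → ℂ := fun x => if x = (g, h) then 1 else 0

/-- The conjugacy class of `r` in `G`, as a `Finset`. -/
def conjClass {G : Type*} [Group G] [Fintype G] (r : G) : Finset G :=
  Finset.image (fun g => g * r * g⁻¹) Finset.univ

/-- The centralizer `Z(r)` of `r` in `G`, as a `Finset`. -/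
def centFinset {G : Type*} [Group G] [Fintype G] (r : G) : Finset G :=
  Finset.univ.filter fun z => z * r = r * z

/-- `ρ : G → Matrix (Fin d) (Fin d) ℂ` restricts to a unitary representation of the
centralizer `Z(r)`. -/
def IsCentRep {G : Type*} [Group G] [Fintype G] (r : G) {d : ℕ}
    (ρ : G → Matrix (Fin d) (Fin d) ℂ) : Prop :=
  ρ 1 = 1 ∧
  (∀ z w : G, z * r = r * z → w * r = r * w → ρ (z * w) = ρ z * ρ w) ∧
  (∀ z : G, z * r = r * z → ρ z ∈ Matrix.unitaryGroup (Fin d) ℂ)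

/-- `ρ` restricts to an irreducible unitary representation of `Z(r)`. -/
def IsCentIrrep {G : Type*} [Group G] [Fintype G] (r : G) {d : ℕ}
    (ρ : G → Matrix (Fin d) (Fin d) ℂ) : Prop :=
  IsCentRep r ρ ∧
  ∀ M : Matrix (Fin d) (Fin d) ℂ,
    (∀ z : G, z * r = r * z → M * ρ z = ρ z * M) →
    ∃ c : ℂ, M = c • (1 : Matrix (Fin d) (Fin d) ℂ)

/-- Isomorphism of two representations of the centralizer `Z(r)`. -/
def RepIsoOn {G : Type*} [Group G] [Fintype G] (r : G) {d₁ d₂ : ℕ}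
    (ρ₁ : G → Matrix (Fin d₁) (Fin d₁) ℂ) (ρ₂ : G → Matrix (Fin d₂) (Fin d₂) ℂ) : Prop :=
  ∃ (U : Matrix (Fin d₁) (Fin d₂) ℂ) (V : Matrix (Fin d₂) (Fin d₁) ℂ),
    U * V = 1 ∧ V * U = 1 ∧ ∀ z : G, z * r = r * z → ρ₁ z * U = U * ρ₂ z

/-- The diagonal probing operator `P^{[C,R]}_{m,c}`. -/
def Pdiag {G : Type*} [Group G] [Fintype G] (r : G) (p : G → G) {d : ℕ}
    (ρ : G → Matrix (Fin d) (Fin d) ℂ) (m : Fin d) (c : G) : G × G → ℂ :=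
  ((((conjClass r).card : ℂ) * (d : ℂ)) / (Fintype.card G : ℂ)) •
    ∑ z ∈ centFinset r, (starRingEnd ℂ) (ρ z m m) • Fgh c (p c * z * (p c)⁻¹)

section UnitaryMatrixRepresentations

open Matrix
open scoped ComplexOrder

variable {H : Type*} [Group H] {m n : Type*} [Fintype m] [Fintype n] [DecidableEq m]
  [DecidableEq n]

/-- A matrix representation by unitary matrices. -/
def IsUnitaryRep (σ : H →* Matrix n n ℂ) : Prop := ∀ z, (σ z)ᴴ = σ z⁻¹

/-- The only matrices commuting with the representation are the scalars. -/
def HasScalarCommutant (σ : H →* Matrix n n ℂ) : Prop :=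
  ∀ M : Matrix n n ℂ, (∀ z, M * σ z = σ z * M) → ∃ c : ℂ, M = c • (1 : Matrix n n ℂ)

lemma IsUnitaryRep.conjTranspose_intertwines {σ : H →* Matrix m m ℂ} {τ : H →* Matrix n n ℂ}
    (uσ : IsUnitaryRep σ) (uτ : IsUnitaryRep τ) {T : Matrix m n ℂ}
    (hT : ∀ z, σ z * T = T * τ z) (z : H) : τ z * Tᴴ = Tᴴ * σ z := by
  have h := (congrArg conjTranspose (hT z⁻¹)).symm
  rwa [conjTranspose_mul, conjTranspose_mul, uσ, uτ, inv_inv] at h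

/-- **Schur's lemma** for unitary matrix representations. -/
lemma HasScalarCommutant.exists_inverse {σ : H →* Matrix m m ℂ} {τ : H →* Matrix n n ℂ}
    (hσ : HasScalarCommutant σ) (hτ : HasScalarCommutant τ)
    (uσ : IsUnitaryRep σ) (uτ : IsUnitaryRep τ) {T : Matrix m n ℂ}
    (hT : ∀ z, σ z * T = T * τ z) (hT0 : T ≠ 0) :
    ∃ V : Matrix n m ℂ, T * V = 1 ∧ V * T = 1 := by
  have hT' := uσ.conjTranspose_intertwines uτ hT
  obtain ⟨a, ha⟩ := hσ (T * Tᴴ) fun z => by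
    rw [Matrix.mul_assoc, ← hT', ← Matrix.mul_assoc, ← hT, Matrix.mul_assoc]
  obtain ⟨b, hb⟩ := hτ (Tᴴ * T) fun z => by
    rw [Matrix.mul_assoc, ← hT, ← Matrix.mul_assoc, ← hT', Matrix.mul_assoc]
  have hab : a = b := by
    have h : a • T = b • T := by
      calc a • T = T * Tᴴ * T := by rw [ha]; simp
        _ = b • T := by rw [Matrix.mul_assoc, hb]; simp
    exact smul_left_injective ℂ hT0 h
  have ha0 : a ≠ 0 := by
    rintro rfl
    exact hT0 (Matrix.self_mul_conjTranspose_eq_zero.mp (by simpa using ha))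
  refine ⟨a⁻¹ • Tᴴ, ?_, ?_⟩
  · rw [Matrix.mul_smul, ha, smul_smul, inv_mul_cancel₀ ha0, one_smul]
  · rw [Matrix.smul_mul, hb, ← hab, smul_smul, inv_mul_cancel₀ ha0, one_smul]

/-- If every Hermitian matrix commuting with a unitary representation is scalar, so is every
commuting matrix. -/
lemma IsUnitaryRep.hasScalarCommutant_of_isHermitian {σ : H →* Matrix n n ℂ}
    (uσ : IsUnitaryRep σ)
    (h : ∀ M : Matrix n n ℂ, M.IsHermitian → (∀ z, M * σ z = σ z * M) →
      ∃ c : ℂ, M = c • (1 : Matrix n n ℂ)) : HasScalarCommutant σ := by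
  intro M hM
  have hM' : ∀ z, Mᴴ * σ z = σ z * Mᴴ := fun z =>
    (uσ.conjTranspose_intertwines uσ (fun w => (hM w).symm) z).symm
  obtain ⟨a, ha⟩ := h (M + Mᴴ) (by simp [IsHermitian, add_comm]) fun z => by
    rw [Matrix.add_mul, Matrix.mul_add, hM, hM']
  obtain ⟨b, hb⟩ := h (Complex.I • (M - Mᴴ)) (by
      simp only [IsHermitian, conjTranspose_smul, conjTranspose_sub, conjTranspose_conjTranspose]
      simp [sub_eq_add_neg, add_comm]) fun z => by
    rw [Matrix.smul_mul, Matrix.mul_smul, Matrix.sub_mul, Matrix.mul_sub, hM, hM']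
  refine ⟨(a - Complex.I * b) / 2, ?_⟩
  have hb' : M - Mᴴ = (-Complex.I * b) • (1 : Matrix n n ℂ) := by
    rw [← smul_smul, ← hb, smul_smul]
    simp
  have h2 : (2 : ℂ) • M = (a - Complex.I * b) • (1 : Matrix n n ℂ) := by
    rw [sub_eq_add_neg, ← neg_mul, add_smul, ← ha, ← hb', two_smul]
    abel
  rw [div_eq_inv_mul, ← smul_smul, ← h2, smul_smul]
  norm_num

/-- Conjugation of a matrix representation by a unitary matrix. -/
def conjRep (σ : H →* Matrix n n ℂ) (U : Matrix n n ℂ) (hU : U * Uᴴ = 1) :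
    H →* Matrix n n ℂ where
  toFun z := Uᴴ * σ z * U
  map_one' := by simp [mul_eq_one_comm.mp hU]
  map_mul' z w := by
    calc Uᴴ * σ (z * w) * U = Uᴴ * σ z * (U * Uᴴ) * σ w * U := by simp [hU, Matrix.mul_assoc]
      _ = Uᴴ * σ z * U * (Uᴴ * σ w * U) := by simp only [Matrix.mul_assoc]

lemma IsUnitaryRep.conjRep {σ : H →* Matrix n n ℂ} (uσ : IsUnitaryRep σ) (U : Matrix n n ℂ)
    (hU : U * Uᴴ = 1) : IsUnitaryRep (conjRep σ U hU) := fun z => by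
  simp [_root_.conjRep, uσ z, Matrix.mul_assoc]

/-- The block of a matrix representation on an index set that it does not leave. -/
def blockRep (σ : H →* Matrix n n ℂ) (s : n → Prop) [DecidablePred s]
    (hs : ∀ z a b, s a → ¬ s b → σ z a b = 0) : H →* Matrix {a // s a} {a // s a} ℂ where
  toFun z := (σ z).submatrix (↑) (↑)
  map_one' := by
    rw [map_one]
    exact submatrix_one_embedding (Function.Embedding.subtype s)
  map_mul' z w := by
    ext a b
    have h0 : ∑ j : {j // ¬ s j}, σ z a j * σ w j b = 0 :=
      Finset.sum_eq_zero fun j _ => by rw [hs z a j a.2 j.2, zero_mul]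
    rw [map_mul, submatrix_apply, Matrix.mul_apply, Matrix.mul_apply,
      ← Fintype.sum_subtype_add_sum_subtype s, h0, add_zero]
    rfl

lemma IsUnitaryRep.blockRep {σ : H →* Matrix n n ℂ} (uσ : IsUnitaryRep σ) (s : n → Prop)
    [DecidablePred s] (hs : ∀ z a b, s a → ¬ s b → σ z a b = 0) :
    IsUnitaryRep (blockRep σ s hs) := fun z => by
  ext a b
  exact congrFun (congrFun (uσ z) a) b

lemma Matrix.IsHermitian.exists_eigenvalues_ne {M : Matrix n n ℂ} (hM : M.IsHermitian)
    (hs : ¬ ∃ c : ℂ, M = c • (1 : Matrix n n ℂ)) (a : n) :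
    ∃ b, hM.eigenvalues b ≠ hM.eigenvalues a := by
  by_contra! h
  refine hs ⟨hM.eigenvalues a, ?_⟩
  have hD : diagonal (RCLike.ofReal ∘ hM.eigenvalues) =
      (hM.eigenvalues a : ℂ) • (1 : Matrix n n ℂ) := by
    rw [smul_one_eq_diagonal]
    congr 1
    ext b
    simp [h b]
  conv_lhs => rw [hM.spectral_theorem, hD]
  simp

variable [Fintype H]

/-- A linear combination of group elements acting as zero in every unitary representation with
scalar commutant acts as zero in every unitary representation. -/
lemma IsUnitaryRep.sum_smul_eq_zero (f : H → ℂ)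
    (hf : ∀ (k : ℕ) (τ : H →* Matrix (Fin k) (Fin k) ℂ), IsUnitaryRep τ →
      HasScalarCommutant τ → ∑ z, f z • τ z = 0)
    {σ : H →* Matrix n n ℂ} (uσ : IsUnitaryRep σ) : ∑ z, f z • σ z = 0 := by
  induction hN : Fintype.card n using Nat.strong_induction_on generalizing n with
  | _ N ih =>
  by_cases hirr : HasScalarCommutant σ
  · let e := reindexAlgEquiv ℂ ℂ (Fintype.equivFin n)
    let τ : H →* Matrix (Fin (Fintype.card n)) (Fin (Fintype.card n)) ℂ :=
      (e : Matrix n n ℂ →* _).comp σ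
    have hτ : ∀ z, τ z = e (σ z) := fun z => rfl
    have h := hf _ τ (fun z => by
        rw [hτ, hτ, ← uσ]
        rfl) fun M hM => by
      obtain ⟨c, hc⟩ := hirr (e.symm M) fun z => e.injective (by
        simpa [hτ] using hM z)
      exact ⟨c, e.symm.injective (by simpa using hc)⟩
    refine e.injective ?_
    rw [map_zero, ← h, map_sum]
    simp [hτ]
  · obtain ⟨M, hM, hcomm, hns⟩ : ∃ M : Matrix n n ℂ, M.IsHermitian ∧
        (∀ z, M * σ z = σ z * M) ∧ ¬ ∃ c : ℂ, M = c • (1 : Matrix n n ℂ) := by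
      by_contra! h
      exact hirr (uσ.hasScalarCommutant_of_isHermitian h)
    let U : Matrix n n ℂ := hM.eigenvectorUnitary
    have hU : U * Uᴴ = 1 := mem_unitaryGroup_iff.mp hM.eigenvectorUnitary.2
    have hU' : Uᴴ * U = 1 := mul_eq_one_comm.mp hU
    let D : Matrix n n ℂ := diagonal (RCLike.ofReal ∘ hM.eigenvalues)
    have hMD : M = U * D * Uᴴ := hM.spectral_theorem
    have hD : D = Uᴴ * M * U := by
      rw [hMD, ← Matrix.mul_assoc, ← Matrix.mul_assoc, hU', Matrix.mul_assoc, hU']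
      simp
    let τ := _root_.conjRep σ U hU
    have hτ : ∀ z, τ z = Uᴴ * σ z * U := fun z => rfl
    have hστ : ∀ z, σ z = U * τ z * Uᴴ := fun z => by
      rw [hτ, ← Matrix.mul_assoc, ← Matrix.mul_assoc, hU, Matrix.mul_assoc, hU]
      simp
    have hDτ : ∀ z, D * τ z = τ z * D := fun z => by
      calc D * τ z = Uᴴ * M * (U * Uᴴ) * σ z * U := by
            rw [hD, hτ]; simp only [Matrix.mul_assoc]
        _ = Uᴴ * (M * σ z) * U := by rw [hU]; simp [Matrix.mul_assoc]
        _ = Uᴴ * σ z * (U * Uᴴ) * M * U := by rw [hU, hcomm]; simp [Matrix.mul_assoc]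
        _ = τ z * D := by rw [hD, hτ]; simp only [Matrix.mul_assoc]
    have hoff : ∀ z a b, hM.eigenvalues b ≠ hM.eigenvalues a → τ z a b = 0 := fun z a b hab => by
      have h := congrFun (congrFun (hDτ z) a) b
      rw [diagonal_mul, mul_diagonal, mul_comm] at h
      by_contra h0
      exact hab (by simpa using (mul_left_cancel₀ h0 h).symm)
    have hτ0 : ∑ z, f z • τ z = 0 := by
      ext a b
      by_cases hab : hM.eigenvalues b = hM.eigenvalues a
      · let s : n → Prop := fun x => hM.eigenvalues x = hM.eigenvalues a
        have hs : ∀ z x y, s x → ¬ s y → τ z x y = 0 := fun z x y hx hy =>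
          hoff z x y fun h => hy (h.trans hx)
        have hcard : Fintype.card {x // s x} < N := by
          obtain ⟨c, hc⟩ := hM.exists_eigenvalues_ne hns a
          exact hN ▸ Fintype.card_subtype_lt (p := s) hc
        have h := ih _ hcard ((uσ.conjRep U hU).blockRep s hs) rfl
        have h' := congrFun (congrFun h ⟨a, rfl⟩) ⟨b, hab⟩
        simp only [Matrix.sum_apply, Matrix.smul_apply, smul_eq_mul] at h' ⊢
        exact h'
      · simp [Matrix.sum_apply, hoff _ a b hab]
    calc ∑ z, f z • σ z = U * (∑ z, f z • τ z) * Uᴴ := by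
          simp [Matrix.mul_sum, Matrix.sum_mul, hστ]
      _ = 0 := by simp [hτ0]

/-- The average of `X` against two representations intertwines them. -/
lemma sum_mul_mul_inv_intertwines (σ : H →* Matrix m m ℂ) (τ : H →* Matrix n n ℂ)
    (X : Matrix m n ℂ) (w : H) :
    σ w * ∑ z, σ z * X * τ z⁻¹ = (∑ z, σ z * X * τ z⁻¹) * τ w := by
  rw [Matrix.mul_sum, Matrix.sum_mul, ← Equiv.sum_comp (Equiv.mulLeft w)
    (fun z => σ z * X * τ z⁻¹ * τ w)]
  refine Finset.sum_congr rfl fun z _ => ?_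
  rw [Matrix.mul_assoc _ (τ _), ← map_mul]
  simp [Matrix.mul_assoc]

lemma sum_mul_single_mul_apply (σ : H →* Matrix m m ℂ) (τ : H →* Matrix n n ℂ) (a : m) (b : n) :
    (∑ z, σ z * single a b (1 : ℂ) * τ z⁻¹) a b = ∑ z, σ z a a * τ z⁻¹ b b := by
  simp [Matrix.sum_apply, Matrix.mul_apply, single_apply, ite_and]

/-- Characters of representations without nonzero intertwiners are orthogonal. -/
lemma sum_trace_mul_trace_inv_eq_zero {σ : H →* Matrix m m ℂ} {τ : H →* Matrix n n ℂ}
    (h : ∀ T : Matrix m n ℂ, (∀ z, σ z * T = T * τ z) → T = 0) :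
    ∑ z, (σ z).trace * (τ z⁻¹).trace = 0 := by
  simp only [trace, diag_apply, Finset.sum_mul_sum]
  rw [Finset.sum_comm]
  refine Finset.sum_eq_zero fun a _ => ?_
  rw [Finset.sum_comm]
  refine Finset.sum_eq_zero fun b _ => ?_
  rw [← sum_mul_single_mul_apply, h _ (sum_mul_mul_inv_intertwines σ τ _), Matrix.zero_apply]

/-- The character of a representation with scalar commutant has norm one. -/
lemma HasScalarCommutant.sum_trace_mul_trace_inv [Nonempty n] {σ : H →* Matrix n n ℂ}
    (hσ : HasScalarCommutant σ) :
    ∑ z, (σ z).trace * (σ z⁻¹).trace = Fintype.card H := by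
  have hn : (Fintype.card n : ℂ) ≠ 0 := by simp
  have key : ∀ a b, ∑ z, σ z a a * σ z⁻¹ b b =
      if a = b then (Fintype.card H : ℂ) / Fintype.card n else 0 := fun a b => by
    obtain ⟨c, hc⟩ := hσ (∑ z, σ z * single a b (1 : ℂ) * σ z⁻¹) fun w =>
      (sum_mul_mul_inv_intertwines σ σ _ w).symm
    rw [← sum_mul_single_mul_apply, hc]
    split_ifs with hab
    · subst hab
      have ht := congrArg trace hc
      have hz : ∀ z, (σ z * single a a (1 : ℂ) * σ z⁻¹).trace = 1 := fun z => by
        rw [trace_mul_comm, ← Matrix.mul_assoc, ← map_mul]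
        simp
      rw [trace_sum, Finset.sum_congr rfl fun z _ => hz z] at ht
      simp only [Finset.sum_const, Finset.card_univ, nsmul_eq_mul, mul_one, trace_smul, trace_one,
        smul_eq_mul] at ht
      rw [ht]
      simp [hn]
    · simp [hab]
  simp only [trace, diag_apply, Finset.sum_mul_sum]
  rw [Finset.sum_comm]
  calc _ = ∑ a : n, ∑ b : n, ∑ z, σ z a a * σ z⁻¹ b b :=
        Finset.sum_congr rfl fun a _ => Finset.sum_comm
    _ = _ := by
      simp only [key]
      simp [mul_div_cancel₀ _ hn]

/-- The left regular representation, by permutation matrices. -/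
def regularRep (H : Type*) [Group H] [Fintype H] [DecidableEq H] : H →* Matrix H H ℂ where
  toFun z := of fun a b => if a = z * b then 1 else 0
  map_one' := by ext a b; simp [Matrix.one_apply]
  map_mul' z w := by
    ext a b
    simp [Matrix.mul_apply, mul_assoc]

lemma isUnitaryRep_regularRep [DecidableEq H] : IsUnitaryRep (regularRep H) := fun z => by
  ext a b
  simp [regularRep, conjTranspose_apply, apply_ite, eq_inv_mul_iff_mul_eq, eq_comm]

/-- **Column orthogonality** at the identity: the sum of `χ(1) χ` over a complete set of
irreducible unitary representations is the character of the regular representation. -/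
lemma sum_card_mul_trace_inv [DecidableEq H] {ι : Type*} [Fintype ι] {d : ι → ℕ}
    (ρ : ∀ i, H →* Matrix (Fin (d i)) (Fin (d i)) ℂ)
    (uρ : ∀ i, IsUnitaryRep (ρ i)) (hρ : ∀ i, HasScalarCommutant (ρ i))
    (hdistinct : ∀ i j, i ≠ j → ¬ ∃ (U : Matrix (Fin (d i)) (Fin (d j)) ℂ)
      (V : Matrix (Fin (d j)) (Fin (d i)) ℂ), U * V = 1 ∧ V * U = 1 ∧ ∀ z, ρ i z * U = U * ρ j z)
    (hcomplete : ∀ (k : ℕ) (σ : H →* Matrix (Fin k) (Fin k) ℂ), IsUnitaryRep σ →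
      HasScalarCommutant σ → ∃ (i : ι) (U : Matrix (Fin k) (Fin (d i)) ℂ)
        (V : Matrix (Fin (d i)) (Fin k) ℂ),
        U * V = 1 ∧ V * U = 1 ∧ ∀ z, σ z * U = U * ρ i z) (z : H) :
    ∑ i, (d i : ℂ) * (ρ i z⁻¹).trace = if z = 1 then (Fintype.card H : ℂ) else 0 := by
  let f : H → ℂ := fun z =>
    (if z = 1 then (Fintype.card H : ℂ) else 0) - ∑ i, (d i : ℂ) * (ρ i z⁻¹).trace
  have hclass : ∀ w z, f (w * z * w⁻¹) = f z := fun w z => by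
    have ht : ∀ i, (ρ i (w * z * w⁻¹)⁻¹).trace = (ρ i z⁻¹).trace := fun i => by
      rw [show (w * z * w⁻¹)⁻¹ = w * (z⁻¹ * w⁻¹) by group, map_mul, trace_mul_comm, ← map_mul]
      simp
    simp only [f, ht, conj_eq_one_iff]
  have hρ0 : ∀ j, ∑ z, f z • ρ j z = 0 := fun j => by
    obtain ⟨c, hc⟩ := hρ j (∑ z, f z • ρ j z) fun w => by
      rw [Matrix.mul_sum, Matrix.sum_mul, ← Equiv.sum_comp (MulAut.conj w).toEquiv]
      refine Finset.sum_congr rfl fun z _ => ?_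
      simp only [MulEquiv.toEquiv_eq_coe, EquivLike.coe_coe, MulAut.conj_apply, hclass,
        Matrix.mul_smul, Matrix.smul_mul, ← map_mul]
      group
    rcases isEmpty_or_nonempty (Fin (d j)) with he | hne
    · exact Subsingleton.elim _ _
    have horth : ∀ i, ∑ z, (ρ i z⁻¹).trace * (ρ j z).trace =
        if i = j then (Fintype.card H : ℂ) else 0 := fun i => by
      split_ifs with hij
      · subst hij
        simpa only [mul_comm] using (hρ i).sum_trace_mul_trace_inv
      · simp only [mul_comm (trace (ρ i _))]
        refine sum_trace_mul_trace_inv_eq_zero fun T hT => ?_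
        by_contra hT0
        obtain ⟨V, h1, h2⟩ := (hρ j).exists_inverse (hρ i) (uρ j) (uρ i) hT hT0
        exact hdistinct j i (Ne.symm hij) ⟨T, V, h1, h2, hT⟩
    have ht := congrArg trace hc
    have ht0 : (∑ z, f z • ρ j z).trace = 0 := by
      calc (∑ z, f z • ρ j z).trace = (Fintype.card H : ℂ) * (ρ j 1).trace -
            ∑ i, (d i : ℂ) * ∑ z, (ρ i z⁻¹).trace * (ρ j z).trace := by
            simp only [trace_sum, trace_smul, smul_eq_mul, f, sub_mul, Finset.sum_sub_distrib,
              ite_mul, zero_mul, Finset.sum_ite_eq', Finset.mem_univ, if_true, Finset.sum_mul,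
              Finset.mul_sum, mul_assoc]
            simp [Finset.sum_comm (s := (Finset.univ : Finset H))]
        _ = 0 := by
            simp only [horth]
            simp [mul_comm]
    rw [ht0, trace_smul, trace_one, smul_eq_mul] at ht
    have hc0 : c = 0 :=
      (mul_eq_zero.mp ht.symm).resolve_right (by simp [(Fin.pos_iff_nonempty.mpr hne).ne'])
    rw [hc, hc0, zero_smul]
  have hreg : ∑ z, f z • regularRep H z = 0 :=
    isUnitaryRep_regularRep.sum_smul_eq_zero f fun k σ uσ hσ => by
      obtain ⟨i, U, V, hUV, -, hU⟩ := hcomplete k σ uσ hσ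
      calc ∑ z, f z • σ z = (∑ z, f z • σ z) * U * V := by
            rw [Matrix.mul_assoc, hUV, Matrix.mul_one]
        _ = U * (∑ z, f z • ρ i z) * V := by
            simp only [Matrix.sum_mul, Matrix.mul_sum, Matrix.smul_mul, Matrix.mul_smul, hU]
        _ = 0 := by simp [hρ0]
  have hz := congrFun (congrFun hreg z) 1
  have hfz : f z = 0 := by simpa [regularRep, Matrix.sum_apply] using hz
  exact (sub_eq_zero.mp hfz).symm

end UnitaryMatrixRepresentations

lemma mem_centFinset {G : Type*} [Group G] [Fintype G] {r z : G} :
    z ∈ centFinset r ↔ z * r = r * z := by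
  simp [centFinset]

lemma card_conjClass_mul_card_centFinset {G : Type*} [Group G] [Fintype G] (r : G) :
    (conjClass r).card * (centFinset r).card = Fintype.card G := by
  rw [← Finset.card_univ, Finset.card_eq_sum_card_image (fun g => g * r * g⁻¹) Finset.univ,
    conjClass, ← smul_eq_mul, ← Finset.sum_const]
  refine Finset.sum_congr rfl fun c hc => ?_
  obtain ⟨g, -, rfl⟩ := Finset.mem_image.mp hc
  refine Finset.card_nbij' (g * ·) (g⁻¹ * ·) (fun z hz => ?_) (fun x hx => ?_)
    (fun z _ => by simp) (fun x _ => by simp)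
  · have hz' : z * r = r * z := mem_centFinset.mp hz
    simp only [Finset.coe_filter, Finset.mem_univ, true_and, Set.mem_ofPred_eq, mul_inv_rev]
    rw [mul_assoc g, hz']
    group
  · have hx' : x * r * x⁻¹ = g * r * g⁻¹ := by simpa using hx
    refine mem_centFinset.mpr ?_
    rw [mul_assoc, mul_inv_eq_iff_eq_mul.mp hx']
    group

section CentralizerRepresentations

open Matrix

variable {G : Type*} [Group G] [Fintype G] {r : G}

/-- The representation of the centralizer subgroup underlying a representation of `Z(r)`. -/
def IsCentRep.toMonoidHom {k : ℕ} {σ : G → Matrix (Fin k) (Fin k) ℂ} (hσ : IsCentRep r σ) :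
    Subgroup.centralizer {r} →* Matrix (Fin k) (Fin k) ℂ where
  toFun z := σ z
  map_one' := hσ.1
  map_mul' z w := hσ.2.1 z w (Subgroup.mem_centralizer_singleton_iff.mp z.2)
    (Subgroup.mem_centralizer_singleton_iff.mp w.2)

lemma IsCentRep.isUnitaryRep {k : ℕ} {σ : G → Matrix (Fin k) (Fin k) ℂ} (hσ : IsCentRep r σ) :
    IsUnitaryRep hσ.toMonoidHom := fun z => by
  have h1 : hσ.toMonoidHom z⁻¹ * hσ.toMonoidHom z = 1 := by simp [← map_mul]
  have h2 : hσ.toMonoidHom z * (hσ.toMonoidHom z)ᴴ = 1 :=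
    mem_unitaryGroup_iff.mp (hσ.2.2 z (Subgroup.mem_centralizer_singleton_iff.mp z.2))
  exact (left_inv_eq_right_inv h1 h2).symm

lemma IsCentIrrep.hasScalarCommutant {k : ℕ} {σ : G → Matrix (Fin k) (Fin k) ℂ}
    (hσ : IsCentIrrep r σ) : HasScalarCommutant hσ.1.toMonoidHom := fun M hM =>
  hσ.2 M fun z hz => hM ⟨z, Subgroup.mem_centralizer_singleton_iff.mpr hz⟩

/-- Every irreducible unitary representation of the centralizer subgroup extends to a function
on `G` that is an irreducible unitary representation of `Z(r)`. -/
lemma exists_isCentIrrep {k : ℕ} (σ : Subgroup.centralizer {r} →* Matrix (Fin k) (Fin k) ℂ)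
    (uσ : IsUnitaryRep σ) (hσ : HasScalarCommutant σ) :
    ∃ τ : G → Matrix (Fin k) (Fin k) ℂ, IsCentIrrep r τ ∧
      ∀ z : Subgroup.centralizer {r}, τ z = σ z := by
  let τ : G → Matrix (Fin k) (Fin k) ℂ := fun z =>
    if hz : z ∈ Subgroup.centralizer {r} then σ ⟨z, hz⟩ else 1
  have hτ : ∀ z : Subgroup.centralizer {r}, τ z = σ z := fun z => dif_pos z.2
  refine ⟨τ, ⟨⟨?_, fun z w hz hw => ?_, fun z hz => ?_⟩, fun M hM => hσ M fun z => ?_⟩, hτ⟩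
  · simpa using hτ 1
  · rw [← Subgroup.mem_centralizer_singleton_iff] at hz hw
    have h := map_mul σ ⟨z, hz⟩ ⟨w, hw⟩
    rwa [← hτ, ← hτ, ← hτ] at h
  · rw [← Subgroup.mem_centralizer_singleton_iff] at hz
    have h := hτ ⟨z, hz⟩
    simp only at h
    rw [mem_unitaryGroup_iff, h, star_eq_conjTranspose, uσ, ← map_mul]
    simp
  · have h := hM z (Subgroup.mem_centralizer_singleton_iff.mp z.2)
    rwa [hτ z] at h

variable {ι : Type*} [Fintype ι] {d : ι → ℕ}

lemma sum_card_mul_sum_conj_diag (ρ : ∀ i, G → Matrix (Fin (d i)) (Fin (d i)) ℂ)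
    (hirr : ∀ i, IsCentIrrep r (ρ i)) (hdistinct : ∀ i j, i ≠ j → ¬ RepIsoOn r (ρ i) (ρ j))
    (hcomplete : ∀ (k : ℕ) (σ : G → Matrix (Fin k) (Fin k) ℂ),
      IsCentIrrep r σ → ∃ i, RepIsoOn r σ (ρ i)) {z : G} (hz : z ∈ centFinset r) :
    ∑ i, (d i : ℂ) * ∑ m, (starRingEnd ℂ) (ρ i z m m) =
      if z = 1 then ((centFinset r).card : ℂ) else 0 := by
  have hmem : ∀ w : G, w ∈ Subgroup.centralizer {r} ↔ w ∈ centFinset r := fun w =>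
    Subgroup.mem_centralizer_singleton_iff.trans mem_centFinset.symm
  have h := sum_card_mul_trace_inv (fun i => (hirr i).1.toMonoidHom)
    (fun i => (hirr i).1.isUnitaryRep) (fun i => (hirr i).hasScalarCommutant)
    (fun i j hij ⟨U, V, h1, h2, hU⟩ => hdistinct i j hij ⟨U, V, h1, h2, fun w hw =>
      hU ⟨w, Subgroup.mem_centralizer_singleton_iff.mpr hw⟩⟩)
    (fun k σ uσ hσ => by
      obtain ⟨τ, hτ, hτσ⟩ := exists_isCentIrrep σ uσ hσ
      obtain ⟨i, U, V, h1, h2, hU⟩ := hcomplete k τ hτ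
      refine ⟨i, U, V, h1, h2, fun w => ?_⟩
      rw [← hτσ w]
      exact hU w (Subgroup.mem_centralizer_singleton_iff.mp w.2))
    ⟨z, (hmem z).mpr hz⟩
  rw [Fintype.card_of_subtype (centFinset r) fun w => (hmem w).symm] at h
  simp only [← (hirr _).1.isUnitaryRep _, Subgroup.mk_eq_one] at h
  exact h

/-- The probing operators attached to a single `c` in the conjugacy class of `r` sum to
`F^{c,e}`. -/
lemma sum_Pdiag_eq_Fgh (p : G → G) (ρ : ∀ i, G → Matrix (Fin (d i)) (Fin (d i)) ℂ)
    (hirr : ∀ i, IsCentIrrep r (ρ i)) (hdistinct : ∀ i j, i ≠ j → ¬ RepIsoOn r (ρ i) (ρ j))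
    (hcomplete : ∀ (k : ℕ) (σ : G → Matrix (Fin k) (Fin k) ℂ),
      IsCentIrrep r σ → ∃ i, RepIsoOn r σ (ρ i)) (c : G) :
    ∑ i, ∑ m, Pdiag r p (ρ i) m c = Fgh c 1 := by
  have hcard : ((conjClass r).card : ℂ) * (centFinset r).card = Fintype.card G := by
    exact_mod_cast card_conjClass_mul_card_centFinset r
  calc ∑ i, ∑ m, Pdiag r p (ρ i) m c
      = ∑ z ∈ centFinset r, (((conjClass r).card : ℂ) / Fintype.card G *
          ∑ i, (d i : ℂ) * ∑ m, (starRingEnd ℂ) (ρ i z m m)) • Fgh c (p c * z * (p c)⁻¹) := by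
        simp only [Pdiag, Finset.smul_sum, Finset.mul_sum, Finset.sum_smul, smul_smul]
        rw [Finset.sum_comm (s := centFinset r)]
        refine Finset.sum_congr rfl fun i _ => ?_
        rw [Finset.sum_comm (s := centFinset r)]
        refine Finset.sum_congr rfl fun m _ => Finset.sum_congr rfl fun z _ => ?_
        congr 1
        ring
    _ = ∑ z ∈ centFinset r, (if z = 1 then (1 : ℂ) else 0) • Fgh c (p c * z * (p c)⁻¹) := by
        refine Finset.sum_congr rfl fun z hz => ?_
        rw [sum_card_mul_sum_conj_diag ρ hirr hdistinct hcomplete hz]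
        split_ifs
        · rw [div_mul_eq_mul_div, hcard, div_self (by simp)]
        · rw [mul_zero]
    _ = Fgh c 1 := by
        simp [ite_smul, mem_centFinset]

end CentralizerRepresentations

/-- Completeness (resolution of the identity) for the diagonal probing operators. -/
theorem probing_operators_complete (G : Type*) [Group G] [Fintype G]
    -- `T` is a set of representatives of the conjugacy classes of `G`
    (T : Finset G) (hT : ∀ g : G, ∃! r, r ∈ T ∧ g ∈ conjClass r)
    -- transversals
    (p : G → G → G) (hp : ∀ r ∈ T, ∀ c ∈ conjClass r, p r c * r * (p r c)⁻¹ = c)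
    -- for each representative, a complete family of pairwise non-isomorphic irreducible
    -- unitary representations of the centralizer
    (ι : G → Type) [∀ r, Fintype (ι r)]
    (d : ∀ r, ι r → ℕ)
    (ρ : ∀ r, ∀ i : ι r, G → Matrix (Fin (d r i)) (Fin (d r i)) ℂ)
    (hirr : ∀ r ∈ T, ∀ i : ι r, IsCentIrrep r (ρ r i))
    (hdistinct : ∀ r ∈ T, ∀ i j : ι r, i ≠ j → ¬ RepIsoOn r (ρ r i) (ρ r j))
    (hcomplete : ∀ r ∈ T, ∀ (d' : ℕ) (σ : G → Matrix (Fin d') (Fin d') ℂ),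
      IsCentIrrep r σ → ∃ i : ι r, RepIsoOn r σ (ρ r i)) :
    ∑ r ∈ T, ∑ i : ι r, ∑ m : Fin (d r i), ∑ c ∈ conjClass r, Pdiag r (p r) (ρ r i) m c
      = ∑ g : G, Fgh g (1 : G) := by
  have hclass : ∀ r ∈ T,
      ∑ i : ι r, ∑ m : Fin (d r i), ∑ c ∈ conjClass r, Pdiag r (p r) (ρ r i) m c =
        ∑ c ∈ conjClass r, Fgh c (1 : G) := fun r hr =>
    (by simp_rw [Finset.sum_comm (s := Finset.univ) (t := conjClass r)] :
      _ = ∑ c ∈ conjClass r, ∑ i : ι r, ∑ m : Fin (d r i), Pdiag r (p r) (ρ r i) m c).trans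
    (Finset.sum_congr rfl fun c _ =>
      sum_Pdiag_eq_Fgh (p r) (ρ r) (hirr r hr) (hdistinct r hr) (hcomplete r hr) c)
  rw [Finset.sum_congr rfl hclass, Finset.sum_comm' (t' := Finset.univ)
    (s' := fun g => T.filter fun r => g ∈ conjClass r) (by simp)]
  refine Finset.sum_congr rfl fun g _ => ?_
  obtain ⟨r, hr, hu⟩ := hT g
  have hs : (T.filter fun r => g ∈ conjClass r) = {r} := by
    ext x
    simp only [Finset.mem_filter, Finset.mem_singleton]
    exact ⟨hu x, fun h => h ▸ hr⟩
  rw [hs, Finset.sum_singleton]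

end
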